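/- If G and H are recursively presented groups whose word problems (as ceers) are both non-universal, then the word problem of the direct product G × H is non-universal. -/

import Mathlib

/-- A predicate on a primcodable type is computably enumerable (c.e.). -/
def CePred {α : Type} [Primcodable α] (p : α → Prop) : Prop :=
  Partrec fun a => Part.assert (p a) fun _ => Part.some ()

/-- The `e`-th c.e. set `W_e`, i.e. the domain of the `e`-th partial computable function. -/
def WSet (e : ℕ) : Set ℕ :=
  {n | ((Denumerable.ofNat Nat.Partrec.Code e).eval n).Dom}

/-- A ceer: a computably enumerable equivalence relation on ℕ. -/
def Ceer (E : ℕ → ℕ → Prop) : Prop :=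
  Equivalence E ∧ CePred fun p : ℕ × ℕ => E p.1 p.2

/-- Computable reducibility of binary relations (on coded types). -/
def Reduction {α β : Type} [Primcodable α] [Primcodable β]
    (E : α → α → Prop) (R : β → β → Prop) : Prop :=
  ∃ f : α → β, Computable f ∧ ∀ a b, E a b ↔ R (f a) (f b)

/-- A relation is universal if every ceer computably reduces to it. -/
def Universal {β : Type} [Primcodable β] (R : β → β → Prop) : Prop :=
  ∀ E : ℕ → ℕ → Prop, Ceer E → Reduction E R

/-- The word problem of a group `G` with respect to a coding `ν` of words. -/
def WP {α G : Type} (ν : α → G) : α → α → Prop := fun a b => ν a = ν b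


/-- Approximation of a c.e. predicate by a primitive recursive function. -/
lemma cePred_approx {α : Type} [Primcodable α] {p : α → Prop} (h : CePred p) :
    ∃ g : ℕ → α → Bool, Primrec₂ g ∧ ∀ a, p a ↔ ∃ s, g s a = true := by
  obtain ⟨c, hc⟩ := Nat.Partrec.Code.exists_code.1 h
  refine ⟨fun s a => (Nat.Partrec.Code.evaln s c (Encodable.encode a)).isSome, ?_, ?_⟩
  · exact Primrec.option_isSome.comp (Nat.Partrec.Code.primrec_evaln.comp
      (Primrec.pair (Primrec.pair Primrec.fst (Primrec.const c))
        (Primrec.encode.comp Primrec.snd)))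
  · intro a
    have h1 : (Nat.Partrec.Code.eval c (Encodable.encode a)).Dom ↔ p a := by
      rw [hc]; simp [Part.assert]
    rw [← h1, Part.dom_iff_mem]
    simp only [Nat.Partrec.Code.evaln_complete, Option.isSome_iff_exists, Option.mem_def]
    exact exists_comm

/-- Existential projections of computable predicates are c.e. -/
lemma cePred_of_exists {α : Type} [Primcodable α] {p : α → Prop} {g : α → ℕ → Bool}
    (hg : Computable₂ g) (h : ∀ a, p a ↔ ∃ s, g a s = true) : CePred p := by
  have h1 : Partrec fun a => Nat.rfind (fun n => Part.some (g a n)) :=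
    Partrec.rfind hg.partrec₂
  refine REPred.of_eq h1.dom_re fun a => ?_
  rw [h]
  constructor
  · intro hd
    obtain ⟨n, hn, -⟩ := Nat.rfind_dom.1 hd
    exact ⟨n, (Part.mem_some_iff.1 hn).symm⟩
  · rintro ⟨s, hs⟩
    exact Nat.rfind_dom.2 ⟨s, Part.mem_some_iff.2 hs.symm, fun _ => trivial⟩

/-- One-step computation of the universal machine. -/
def uStep (x v : ℕ) : Prop :=
  v ∈ (Denumerable.ofNat Nat.Partrec.Code x.unpair.1).eval x.unpair.2

/-- The iterated universal function with fuel. -/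
def uIter (s m x : ℕ) : Option ℕ :=
  (fun o : Option ℕ => o.bind fun y =>
    (Denumerable.ofNat Nat.Partrec.Code y.unpair.1).evaln s y.unpair.2)^[m] (some x)

lemma uIter_succ (s m x : ℕ) : uIter s (m+1) x = (uIter s m x).bind fun y =>
    (Denumerable.ofNat Nat.Partrec.Code y.unpair.1).evaln s y.unpair.2 := by
  simp [uIter, Function.iterate_succ_apply']

lemma uIter_primrec : Primrec fun a : (ℕ × ℕ) × ℕ => uIter a.1.1 a.1.2 a.2 := by
  unfold uIter
  refine Primrec.nat_iterate (Primrec.snd.comp Primrec.fst)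
    (Primrec.option_some.comp Primrec.snd) ?_
  refine Primrec.option_bind Primrec.snd ?_
  refine Nat.Partrec.Code.primrec_evaln.comp (Primrec.pair (Primrec.pair
    (Primrec.fst.comp (Primrec.fst.comp (Primrec.fst.comp Primrec.fst)))
    ((Primrec.ofNat _).comp (Primrec.fst.comp (Primrec.unpair.comp Primrec.snd))))
    (Primrec.snd.comp (Primrec.unpair.comp Primrec.snd)))

lemma uIter_mono {s t m x z : ℕ} (h : s ≤ t) (hz : uIter s m x = some z) :
    uIter t m x = some z := by
  induction m generalizing z with
  | zero => simpa [uIter] using hz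
  | succ m ih =>
    rw [uIter_succ, Option.bind_eq_some_iff] at *
    obtain ⟨y, hy, hz⟩ := hz
    exact ⟨y, ih hy, Nat.Partrec.Code.evaln_mono h hz⟩

lemma uStep_rtg {x z : ℕ} : Relation.ReflTransGen uStep x z ↔ ∃ s m, uIter s m x = some z := by
  constructor
  · intro h
    induction h with
    | refl => exact ⟨0, 0, rfl⟩
    | tail _ h2 ih =>
      obtain ⟨s, m, hs⟩ := ih
      obtain ⟨t, ht⟩ := Nat.Partrec.Code.evaln_complete.1 h2
      refine ⟨max s t, m+1, ?_⟩
      rw [uIter_succ, uIter_mono (le_max_left _ _) hs]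
      exact Nat.Partrec.Code.evaln_mono (le_max_right _ _) ht
  · rintro ⟨s, m, h⟩
    induction m generalizing z with
    | zero => 
      have : x = z := by simpa [uIter] using h
      rw [this]
    | succ m ih =>
      rw [uIter_succ, Option.bind_eq_some_iff] at h
      obtain ⟨y, hy, hz⟩ := h
      exact (ih hy).tail (Nat.Partrec.Code.evaln_sound hz)

/-- The universal precomplete ceer. -/
def uCeer : ℕ → ℕ → Prop := Relation.Join (Relation.ReflTransGen uStep)

lemma uCeer_ceer : Ceer uCeer := by
  refine ⟨Relation.equivalence_join_reflTransGen fun a b c h1 h2 => ?_, ?_⟩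
  · have : b = c := Part.mem_unique h1 h2
    subst this
    exact ⟨b, .refl, .refl⟩
  · refine cePred_of_exists (g := fun p w =>
      (uIter w.unpair.1 w.unpair.2.unpair.1 p.1).isSome &&
      decide (uIter w.unpair.1 w.unpair.2.unpair.1 p.1 =
       uIter w.unpair.1 w.unpair.2.unpair.2 p.2)) ?_ ?_
    · apply Primrec.to_comp
      have hs : Primrec fun q : (ℕ × ℕ) × ℕ => q.2.unpair.1 :=
        Primrec.fst.comp (Primrec.unpair.comp Primrec.snd)
      have hr : Primrec fun q : (ℕ × ℕ) × ℕ => q.2.unpair.2.unpair :=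
        Primrec.unpair.comp (Primrec.snd.comp (Primrec.unpair.comp Primrec.snd))
      have h1 : Primrec fun q : (ℕ × ℕ) × ℕ =>
          uIter q.2.unpair.1 q.2.unpair.2.unpair.1 q.1.1 :=
        uIter_primrec.comp (Primrec.pair (Primrec.pair hs (Primrec.fst.comp hr))
          (Primrec.fst.comp Primrec.fst))
      have h2 : Primrec fun q : (ℕ × ℕ) × ℕ =>
          uIter q.2.unpair.1 q.2.unpair.2.unpair.2 q.1.2 :=
        uIter_primrec.comp (Primrec.pair (Primrec.pair hs (Primrec.snd.comp hr))
          (Primrec.snd.comp Primrec.fst))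
      exact Primrec.and.comp (Primrec.option_isSome.comp h1) (Primrec.eq.comp h1 h2).decide
    · rintro ⟨x, y⟩
      simp only [uCeer, Relation.Join, uStep_rtg, Bool.and_eq_true, decide_eq_true_eq]
      constructor
      · rintro ⟨z, ⟨s, m, h1⟩, ⟨t, n, h2⟩⟩
        refine ⟨Nat.pair (max s t) (Nat.pair m n), ?_⟩
        simp [uIter_mono (le_max_left s t) h1, uIter_mono (le_max_right s t) h2]
      · rintro ⟨w, h1, h2⟩
        obtain ⟨z, hz⟩ := Option.isSome_iff_exists.1 h1
        exact ⟨z, ⟨_, _, hz⟩, ⟨_, _, h2 ▸ hz⟩⟩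

lemma uCeer_step (c : Nat.Partrec.Code) (n v : ℕ) (h : v ∈ c.eval n) :
    uCeer (Nat.pair (Encodable.encode c) n) v := by
  refine ⟨v, .single ?_, .refl⟩
  simpa [uStep] using h

lemma uCeer_nontrivial : ∃ a b, ¬ uCeer a b := by
  obtain ⟨c, hc⟩ := Nat.Partrec.Code.exists_code.1 Nat.Partrec.none
  have key : ∀ n z, Relation.ReflTransGen uStep (Nat.pair (Encodable.encode c) n) z →
      z = Nat.pair (Encodable.encode c) n := by
    intro n z h
    rcases Relation.ReflTransGen.cases_head h with h | ⟨y, hy, -⟩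
    · exact h.symm
    · simp [uStep, hc] at hy
  refine ⟨Nat.pair (Encodable.encode c) 0, Nat.pair (Encodable.encode c) 1, ?_⟩
  rintro ⟨z, h0, h1⟩
  have := (key _ _ h0).symm.trans (key _ _ h1)
  simp at this

/-- Bounded disjunction. -/
def anyLe (g : ℕ → Bool) (n : ℕ) : Bool := Nat.rec false (fun m ih => g m || ih) (n+1)

lemma anyLe_iff (g : ℕ → Bool) (n : ℕ) : anyLe g n = true ↔ ∃ m ≤ n, g m = true := by
  have : ∀ k, (Nat.rec false (fun m ih => g m || ih) k : Bool) = true ↔ ∃ m < k, g m = true := by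
    intro k
    induction k with
    | zero => simp
    | succ k ih =>
      simp only [Bool.or_eq_true, ih]
      constructor
      · rintro (h | ⟨m, hm, h⟩)
        · exact ⟨k, by omega, h⟩
        · exact ⟨m, by omega, h⟩
      · rintro ⟨m, hm, h⟩
        rcases Nat.lt_succ_iff_lt_or_eq.1 hm with h' | rfl
        · exact Or.inr ⟨m, h', h⟩
        · exact Or.inl h
  exact (this (n+1)).trans (by simp only [Nat.lt_succ_iff])

lemma anyLe_primrec {α : Type} [Primcodable α] {g : α → ℕ → Bool} {f : α → ℕ} (hg : Primrec₂ g)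
    (hf : Primrec f) : Primrec fun a => anyLe (g a) (f a) := by
  unfold anyLe
  refine Primrec.nat_rec' (h := fun a p => g a p.1 || p.2) (Primrec.succ.comp hf)
    (Primrec.const false) ?_
  exact Primrec.or.comp (hg.comp Primrec.fst (Primrec.fst.comp Primrec.snd))
    (Primrec.snd.comp Primrec.snd)

/-- `j` is seen at stage `s` to be equivalent to a smaller number. -/
def evE (gE : ℕ → ℕ × ℕ → Bool) (j s : ℕ) : Bool :=
  decide (s.unpair.1 < j) && gE s.unpair.2 (s.unpair.1, j)

/-- Stage `s` shows a bad collapse. -/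
def evP (gE gA : ℕ → ℕ × ℕ → Bool) (c s : ℕ) : Bool :=
  (!(s.unpair.1.unpair.1 == s.unpair.1.unpair.2) &&
    gA s.unpair.2 (Nat.pair c s.unpair.1.unpair.1, Nat.pair c s.unpair.1.unpair.2)) &&
  (!(anyLe (evE gE s.unpair.1.unpair.1) s) && !(anyLe (evE gE s.unpair.1.unpair.2) s))

/-- The strategy at stage `s`. -/
def strat (gE gA : ℕ → ℕ × ℕ → Bool) (a b c j s : ℕ) : Option ℕ :=
  bif evE gE j s then some (Nat.pair c s.unpair.1) else
  bif evP gE gA c s then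
    (bif j == s.unpair.1.unpair.1 then some a else
      bif j == s.unpair.1.unpair.2 then some b else none)
  else none

lemma evE_primrec {gE : ℕ → ℕ × ℕ → Bool} (hE : Primrec₂ gE) : Primrec₂ (evE gE) := by
  have h1 : Primrec fun q : ℕ × ℕ => q.2.unpair.1 :=
    Primrec.fst.comp (Primrec.unpair.comp Primrec.snd)
  have h2 : Primrec fun q : ℕ × ℕ => q.2.unpair.2 :=
    Primrec.snd.comp (Primrec.unpair.comp Primrec.snd)
  refine Primrec.and.comp ?_ (hE.comp h2 (Primrec.pair h1 Primrec.fst))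
  exact (Primrec.nat_lt.comp h1 Primrec.fst).decide

lemma evP_primrec {gE gA : ℕ → ℕ × ℕ → Bool} (hE : Primrec₂ gE) (hA : Primrec₂ gA) :
    Primrec₂ (evP gE gA) := by
  have h2 : Primrec fun q : ℕ × ℕ => q.2.unpair.2 :=
    Primrec.snd.comp (Primrec.unpair.comp Primrec.snd)
  have h1 : Primrec fun q : ℕ × ℕ => q.2.unpair.1.unpair :=
    Primrec.unpair.comp (Primrec.fst.comp (Primrec.unpair.comp Primrec.snd))
  have hi := Primrec.fst.comp h1
  have hk := Primrec.snd.comp h1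
  have hany : ∀ {f : ℕ × ℕ → ℕ}, Primrec f →
      Primrec fun q : ℕ × ℕ => !(anyLe (evE gE (f q)) q.2) := fun {f} hf =>
    Primrec.not.comp (anyLe_primrec (g := fun q => evE gE (f q))
      ((evE_primrec hE).comp (hf.comp Primrec.fst) Primrec.snd) Primrec.snd)
  refine Primrec.and.comp (Primrec.and.comp (Primrec.not.comp (Primrec.beq.comp hi hk)) ?_)
    (Primrec.and.comp (hany hi) (hany hk))
  exact hA.comp h2 (Primrec.pair (Primrec₂.natPair.comp Primrec.fst hi)
    (Primrec₂.natPair.comp Primrec.fst hk))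

lemma strat_primrec {gE gA : ℕ → ℕ × ℕ → Bool} (hE : Primrec₂ gE) (hA : Primrec₂ gA) (a b : ℕ) :
    Primrec fun q : (Nat.Partrec.Code × ℕ) × ℕ =>
      strat gE gA a b (Encodable.encode q.1.1) q.1.2 q.2 := by
  have hc : Primrec fun q : (Nat.Partrec.Code × ℕ) × ℕ => Encodable.encode q.1.1 :=
    Primrec.encode.comp (Primrec.fst.comp Primrec.fst)
  have hj : Primrec fun q : (Nat.Partrec.Code × ℕ) × ℕ => q.1.2 :=
    Primrec.snd.comp Primrec.fst
  have hl : Primrec fun q : (Nat.Partrec.Code × ℕ) × ℕ => q.2.unpair.1 :=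
    Primrec.fst.comp (Primrec.unpair.comp Primrec.snd)
  have h1 := Primrec.unpair.comp hl
  refine Primrec.cond ((evE_primrec hE).comp hj Primrec.snd)
    (Primrec.option_some.comp (Primrec₂.natPair.comp hc hl)) ?_
  refine Primrec.cond ((evP_primrec hE hA).comp hc Primrec.snd) ?_ (Primrec.const none)
  refine Primrec.cond (Primrec.beq.comp hj (Primrec.fst.comp h1)) (Primrec.const _) ?_
  exact Primrec.cond (Primrec.beq.comp hj (Primrec.snd.comp h1)) (Primrec.const _)
    (Primrec.const _)

lemma mem_rfindOpt_of_first {f : ℕ → Option ℕ} {s v : ℕ} (h : f s = some v)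
    (hlt : ∀ m < s, f m = none) : v ∈ Nat.rfindOpt f := by
  refine Part.mem_bind_iff.2 ⟨s, ?_, by simp [h]⟩
  refine Nat.mem_rfind.2 ⟨by simp [h], fun {m} hm => by simp [hlt m hm]⟩

/-- Every nontrivial ceer coarser than `uCeer` is universal. -/
lemma universal_of_coarser {A : ℕ → ℕ → Prop} (hA : Ceer A) (hU : ∀ x y, uCeer x y → A x y)
    {a b : ℕ} (hab : ¬ A a b) : Universal A := by
  intro E hE
  obtain ⟨gA, pA, iA⟩ := cePred_approx hA.2
  obtain ⟨gE, pE, iE⟩ := cePred_approx hE.2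
  have hpart : Partrec₂ fun (c : Nat.Partrec.Code) (j : ℕ) =>
      Nat.rfindOpt (strat gE gA a b (Encodable.encode c) j) :=
    Partrec.rfindOpt (f := fun (q : Nat.Partrec.Code × ℕ) s =>
      strat gE gA a b (Encodable.encode q.1) q.2 s) (strat_primrec pE pA a b).to_comp
  obtain ⟨c, hc⟩ := Nat.Partrec.Code.fixed_point₂ hpart
  set e := Encodable.encode c with he
  have hstep : ∀ j v, v ∈ Nat.rfindOpt (strat gE gA a b e j) → A (Nat.pair e j) v := by
    intro j v hv
    exact hU _ _ (uCeer_step c j v (by rw [hc]; exact hv))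
  -- no bad event
  have hno : ∀ s, evP gE gA e s = false := by
    by_contra hcon
    have hex : ∃ s, evP gE gA e s = true := by simpa using hcon
    classical
    obtain ⟨s, hs, hmin⟩ : ∃ s, evP gE gA e s = true ∧ ∀ m < s, evP gE gA e m = false :=
      ⟨Nat.find hex, Nat.find_spec hex, fun m hm => by simpa using Nat.find_min hex hm⟩
    have hs' := hs
    simp only [evP, Bool.and_eq_true, Bool.not_eq_true', ← Bool.not_eq_true, anyLe_iff,
      beq_iff_eq, not_exists, not_and] at hs'
    obtain ⟨⟨hik, hgA⟩, hi, hk⟩ := hs'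
    have h1 := hstep s.unpair.1.unpair.1 a (mem_rfindOpt_of_first (s := s)
      (by simp [strat, hs, hi s le_rfl]) (fun m hm => by simp [strat, hmin m hm, hi m hm.le]))
    have h2 := hstep s.unpair.1.unpair.2 b (mem_rfindOpt_of_first (s := s)
      (by simp [strat, hs, hk s le_rfl, beq_false_of_ne (Ne.symm hik)])
      (fun m hm => by simp [strat, hmin m hm, hk m hm.le]))
    have h3 := (iA (_, _)).2 ⟨_, hgA⟩
    exact hab (hA.1.trans (hA.1.symm h1) (hA.1.trans h3 h2))
  -- each number has a minimal representative
  have hrep : ∀ j, ∃ i, E i j ∧ A (Nat.pair e i) (Nat.pair e j) ∧ ∀ l < i, ¬ E l i := by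
    intro j
    induction j using Nat.strong_induction_on with
    | _ j ih =>
      by_cases hj : ∃ l < j, E l j
      · obtain ⟨l, hl, hlj⟩ := hj
        obtain ⟨t, ht⟩ := (iE (l, j)).1 hlj
        have hdom : (Nat.rfindOpt (strat gE gA a b e j)).Dom := by
          rw [Nat.rfindOpt_dom]
          exact ⟨Nat.pair l t, Nat.pair e l, by simp [strat, evE, hl, ht]⟩
        obtain ⟨v, hv⟩ := Part.dom_iff_mem.1 hdom
        obtain ⟨s, hs⟩ := Nat.rfindOpt_spec hv
        have hA1 := hstep j v hv
        cases hev : evE gE j s with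
        | false => simp [strat, hev, hno] at hs
        | true =>
          have hs2 : Nat.pair e s.unpair.1 = v := by simpa [strat, hev] using hs
          simp only [evE, Bool.and_eq_true, decide_eq_true_eq] at hev
          have hE1 : E s.unpair.1 j := (iE (_, _)).2 ⟨_, hev.2⟩
          obtain ⟨i, h1, h2, h3⟩ := ih _ hev.1
          refine ⟨i, hE.1.trans h1 hE1, hA.1.trans h2 ?_, h3⟩
          rw [hs2]
          exact hA.1.symm hA1
      · exact ⟨j, hE.1.refl j, hA.1.refl _, fun l hl h => hj ⟨l, hl, h⟩⟩
  have hmin : ∀ i k, (∀ l < i, ¬ E l i) → (∀ l < k, ¬ E l k) →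
      A (Nat.pair e i) (Nat.pair e k) → i = k := by
    intro i k hi hk h
    by_contra hne
    obtain ⟨t, ht⟩ := (iA (_, _)).1 h
    have hev : ∀ i s, (∀ l < i, ¬ E l i) → ¬ evE gE i s = true := by
      intro i s hi hev
      simp only [evE, Bool.and_eq_true, decide_eq_true_eq] at hev
      exact hi _ hev.1 ((iE (_, _)).2 ⟨_, hev.2⟩)
    have : evP gE gA e (Nat.pair (Nat.pair i k) t) = true := by
      simp only [evP, Bool.and_eq_true, Bool.not_eq_true', ← Bool.not_eq_true, anyLe_iff,
        beq_iff_eq, not_exists, not_and, Nat.unpair_pair]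
      exact ⟨⟨hne, ht⟩, fun s _ => hev i s hi, fun s _ => hev k s hk⟩
    rw [hno] at this
    exact absurd this (by simp)
  refine ⟨fun j => Nat.pair e j, (Primrec₂.natPair.comp (Primrec.const e) Primrec.id).to_comp, ?_⟩
  intro x y
  obtain ⟨i, hi1, hi2, hi3⟩ := hrep x
  obtain ⟨k, hk1, hk2, hk3⟩ := hrep y
  constructor
  · intro hxy
    have hik : E i k := hE.1.trans hi1 (hE.1.trans hxy (hE.1.symm hk1))
    have : i = k := by
      rcases lt_trichotomy i k with h | h | h
      · exact absurd hik (hk3 _ h)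
      · exact h
      · exact absurd (hE.1.symm hik) (hi3 _ h)
    subst this
    exact hA.1.trans (hA.1.symm hi2) hk2
  · intro hxy
    have := hmin i k hi3 hk3 (hA.1.trans hi2 (hA.1.trans hxy (hA.1.symm hk2)))
    subst this
    exact hE.1.trans (hE.1.symm hi1) hk1

/-- Pullback: if a nontrivial pullback of `R` is coarser than `uCeer`, then `R` is universal. -/
lemma universal_of_pullback {R : ℕ → ℕ → Prop} (hR : Ceer R) {g : ℕ → ℕ} (hg : Computable g)
    (hU : ∀ x y, uCeer x y → R (g x) (g y)) {a b : ℕ} (hab : ¬ R (g a) (g b)) : Universal R := by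
  have hA : Ceer fun x y => R (g x) (g y) :=
    ⟨⟨fun x => hR.1.refl _, fun h => hR.1.symm h, fun h h' => hR.1.trans h h'⟩,
      Partrec.comp hR.2 ((hg.comp Computable.fst).pair (hg.comp Computable.snd))⟩
  intro E hE
  obtain ⟨f, hf, h⟩ := universal_of_coarser hA hU hab E hE
  exact ⟨fun x => g (f x), hg.comp hf, h⟩

/-- If `G` and `H` are recursively presented groups (given by surjective codings `νG`, `νH` of
words onto the group elements, whose word problems are ceers) and neither word problem is
universal, then the word problem of the direct product `G × H` (words coded by pairs,
evaluated coordinatewise) is not universal. -/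
theorem stmt4 {G H : Type} [Group G] [Group H]
    (νG : ℕ → G) (νH : ℕ → H)
    (hsG : Function.Surjective νG) (hsH : Function.Surjective νH)
    (hceG : Ceer (WP νG)) (hceH : Ceer (WP νH))
    (hnG : ¬ Universal (WP νG)) (hnH : ¬ Universal (WP νH)) :
    ¬ Universal (WP (fun n : ℕ =>
        ((νG (Nat.unpair n).1, νH (Nat.unpair n).2) : G × H))) := by
  intro hUniv
  obtain ⟨f, hf, h⟩ := hUniv uCeer uCeer_ceer
  obtain ⟨a, b, hab⟩ := uCeer_nontrivial
  have h' : ∀ x y, uCeer x y ↔ WP νG (f x).unpair.1 (f y).unpair.1 ∧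
      WP νH (f x).unpair.2 (f y).unpair.2 := by
    intro x y
    rw [h]
    simp [WP, Prod.ext_iff]
  have h1 : Computable fun x => (f x).unpair.1 :=
    Computable.fst.comp (Computable.unpair.comp hf)
  have h2 : Computable fun x => (f x).unpair.2 :=
    Computable.snd.comp (Computable.unpair.comp hf)
  by_cases hG : WP νG (f a).unpair.1 (f b).unpair.1
  · by_cases hH : WP νH (f a).unpair.2 (f b).unpair.2
    · exact hab ((h' a b).2 ⟨hG, hH⟩)
    · exact hnH (universal_of_pullback hceH h2 (fun x y hxy => ((h' x y).1 hxy).2) hH)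
  · exact hnG (universal_of_pullback hceG h1 (fun x y hxy => ((h' x y).1 hxy).1) hG)
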